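/- arXiv:2110.15395 — 4 statements merged into one kernel-verified Lean document; each statement's English description precedes it below -/
import Mathlib

section
/- For every state s and every operation σ, if s' = apply s σ is a bad update of s (that is, s' ≠ s and s' ≠ goodStep(s)), then applying the good step to s' returns the original state: goodStep(s') = s. In other words, any bad update followed by the good update results back in the original state. -/
/-- Operations: confirm (•), append a bit, delete the last bit. -/
inductive Op where
  | confirm : Op
  | app : Bool → Op
  | del : Op
  deriving DecidableEq

/-- Apply an operation to a state `(yh, c)`. -/
def applyOp : List Bool × ℕ → Op → List Bool × ℕ
  | (yh, c), Op.confirm => (yh, c + 1)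
  | (yh, c + 1), _ => (yh, c)
  | (yh, 0), Op.app b => (yh ++ [b], 0)
  | (yh, 0), Op.del => (yh.dropLast, 0)

/-- The correct operation `op_y(yh)` with respect to the target string `y`. -/
def opy (y yh : List Bool) : Op :=
  if yh = y then Op.confirm
  else if h : yh.length < y.length ∧ yh <+: y then Op.app (y.get ⟨yh.length, h.1⟩)
  else Op.del

/-- The good step: apply the correct operation. -/
def goodStep (y : List Bool) (s : List Bool × ℕ) : List Bool × ℕ :=
  applyOp s (opy y s.1)

/-- Length of the longest common prefix of two boolean strings. -/
def lcp : List Bool → List Bool → ℕ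
  | a :: as, b :: bs => if a = b then lcp as bs + 1 else 0
  | _, _ => 0

theorem opy_self (y : List Bool) : opy y y = Op.confirm := by simp [opy]

theorem opy_ne_confirm {y yh : List Bool} (h : yh ≠ y) : opy y yh ≠ Op.confirm := by
  unfold opy
  split_ifs <;> simp_all

theorem applyOp_succ {σ : Op} (hσ : σ ≠ Op.confirm) (yh : List Bool) (c : ℕ) :
    applyOp (yh, c + 1) σ = (yh, c) := by
  cases σ <;> simp_all [applyOp]

/-- The correct operation on a string that extends to a prefix of `y` by the bit `b`
is to append `b`. -/
theorem opy_of_append_prefix {y yh : List Bool} {b : Bool} (h : yh ++ [b] <+: y) :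
    opy y yh = Op.app b := by
  obtain ⟨t, rfl⟩ := h
  simp [opy]

theorem opy_of_not_prefix {y yh : List Bool} (h : ¬ yh <+: y) : opy y yh = Op.del := by
  have hne : yh ≠ y := by
    rintro rfl
    exact h List.prefix_rfl
  simp [opy, hne, h]

/-- Any bad update followed by the good update results back in the original state. -/
theorem bad_update_then_good_update (y : List Bool) (hn : 1 ≤ y.length)
    (s : List Bool × ℕ) (σ : Op)
    (hne : applyOp s σ ≠ s) (hbad : applyOp s σ ≠ goodStep y s) :
    goodStep y (applyOp s σ) = s := by
  obtain ⟨yh, c⟩ := s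
  have hop : σ ≠ opy y yh := by
    rintro rfl
    exact hbad rfl
  by_cases hσ : σ = Op.confirm
  · subst hσ
    exact applyOp_succ hop.symm yh c
  cases c with
  | succ c =>
    have hy : yh = y := by
      by_contra hy
      exact hbad ((applyOp_succ hσ yh c).trans (applyOp_succ (opy_ne_confirm hy) yh c).symm)
    subst hy
    rw [applyOp_succ hσ]
    simp [goodStep, opy_self, applyOp]
  | zero =>
    cases σ with
    | confirm => exact absurd rfl hσ
    | app b =>
      have hp : ¬ yh ++ [b] <+: y := fun hp => hop (opy_of_append_prefix hp).symm
      simp [goodStep, applyOp, opy_of_not_prefix hp]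
    | del =>
      have hp : yh <+: y := by
        by_contra hp
        exact hop (opy_of_not_prefix hp).symm
      rcases List.eq_nil_or_concat yh with rfl | ⟨l, b, rfl⟩
      · exact absurd rfl hne
      · rw [List.concat_eq_append] at *
        simp [goodStep, applyOp, opy_of_append_prefix hp]
end

section
/- Every good update increases the potential h by exactly one: for every state s, h(goodStep(s)) = h(s) + 1. -/
/-- The potential `h(yh, c)`. -/
def pot (y : List Bool) (s : List Bool × ℕ) : ℤ :=
  if s.1 = y then (y.length : ℤ) + s.2
  else 2 * (lcp s.1 y : ℤ) - s.1.length - s.2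

theorem lcp_eq_length_of_prefix : ∀ {x y : List Bool}, x <+: y → lcp x y = x.length
  | [], _, _ => by simp [lcp]
  | a :: as, [], h => by simp at h
  | a :: as, b :: bs, h => by
    have h' := List.cons_prefix_cons.mp h
    simp [lcp, h'.1, lcp_eq_length_of_prefix h'.2]

theorem lcp_dropLast_of_not_prefix :
    ∀ {x y : List Bool}, ¬ x <+: y → lcp x.dropLast y = lcp x y
  | [], _, h => absurd List.nil_prefix h
  | [a], [], _ => by simp [lcp]
  | [a], b :: bs, h => by
    have hab : a ≠ b := by simpa [List.cons_prefix_cons] using h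
    simp [lcp, hab]
  | a :: a' :: as, [], _ => by simp [lcp]
  | a :: a' :: as, b :: bs, h => by
    rw [List.dropLast_cons_of_ne_nil (List.cons_ne_nil _ _)]
    by_cases hab : a = b
    · have h' : ¬ (a' :: as) <+: bs := fun h' => h (List.cons_prefix_cons.mpr ⟨hab, h'⟩)
      have ih := lcp_dropLast_of_not_prefix h'
      simp only [lcp, hab, if_true, ih]
    · simp only [lcp, hab, if_false]

theorem pot_zero (y yh : List Bool) : pot y (yh, 0) = 2 * (lcp yh y : ℤ) - yh.length := by
  by_cases h : yh = y
  · subst h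
    simp only [pot, if_true, lcp_eq_length_of_prefix List.prefix_rfl]
    push_cast
    ring
  · simp [pot, h]

/-- Every good update increases the potential `h` by exactly one. -/
theorem pot_goodStep (y : List Bool) (hn : 1 ≤ y.length) (s : List Bool × ℕ) :
    pot y (goodStep y s) = pot y s + 1 := by
  obtain ⟨yh, c⟩ := s
  by_cases hy : yh = y
  · subst hy
    simp [goodStep, opy, applyOp, pot, add_assoc]
  by_cases hp : yh.length < y.length ∧ yh <+: y
  · cases c with
    | zero =>
      have hstep := lcp_eq_length_of_prefix (List.concat_get_prefix hp.2 hp.1)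
      simp only [goodStep, opy, hy, hp, and_self, if_false, dif_pos, applyOp, pot_zero, hstep,
        lcp_eq_length_of_prefix hp.2, List.length_append, List.length_singleton]
      push_cast
      ring
    | succ c =>
      simp only [goodStep, opy, hy, hp, and_self, if_false, dif_pos, applyOp, pot]
      push_cast
      ring
  · cases c with
    | zero =>
      have hnp : ¬ yh <+: y := fun h =>
        hp ⟨lt_of_le_of_ne h.length_le fun e => hy (h.eq_of_length e), h⟩
      have hpos : 1 ≤ yh.length := by
        rcases yh with _ | ⟨a, as⟩
        · exact absurd List.nil_prefix hnp
        · simp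
      simp only [goodStep, opy, hy, hp, if_false, dite_false, applyOp, pot_zero,
        lcp_dropLast_of_not_prefix hnp, List.length_dropLast]
      push_cast [Nat.cast_sub hpos]
      ring
    | succ c =>
      simp only [goodStep, opy, hy, hp, if_false, dite_false, applyOp, pot]
      push_cast
      ring
end

section
/- (Lemma: characterization of correct decoding by the update potential.) For every update sequence s₀, s₁, …, s_m starting from the initial state s₀ = (∅, 0), the first component of the final state s_m equals y if and only if the number of good updates minus the number of bad updates in the sequence is at least n, i.e., ŷ_m = y ↔ g − b ≥ n. -/
theorem lcp_le_length_left (a y : List Bool) : lcp a y ≤ a.length := by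
  induction a generalizing y with
  | nil => simp [lcp]
  | cons x a ih =>
    cases y with
    | nil => simp [lcp]
    | cons z y => have := ih y; simp only [lcp, List.length_cons]; split_ifs <;> omega

theorem lcp_le_length_right (a y : List Bool) : lcp a y ≤ y.length := by
  induction a generalizing y with
  | nil => simp [lcp]
  | cons x a ih =>
    cases y with
    | nil => simp [lcp]
    | cons z y => have := ih y; simp only [lcp, List.length_cons]; split_ifs <;> omega

theorem lcp_eq_length_left_iff (a y : List Bool) : lcp a y = a.length ↔ a <+: y := by
  induction a generalizing y with
  | nil => simp [lcp]
  | cons x a ih =>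
    cases y with
    | nil => simp [lcp]
    | cons z y =>
      by_cases h : x = z <;> simp [lcp, h, ih, List.cons_prefix_cons]

theorem lcp_append_singleton_of_not_prefix_concat (a y : List Bool) (b : Bool)
    (h : ¬ a ++ [b] <+: y) : lcp (a ++ [b]) y = lcp a y := by
  induction a generalizing y with
  | nil => cases y <;> simp_all [lcp, List.cons_prefix_cons]
  | cons x a ih =>
    cases y with
    | nil => simp [lcp]
    | cons z y =>
      by_cases hx : x = z
      · subst hx
        simpa [lcp] using ih y (by simpa [List.cons_prefix_cons] using h)
      · simp [lcp, hx]

/-- Signed distance of a string to the target, counting each agreeing bit as `1` and each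
superfluous bit as `-1`. -/
def prefixPotential (y a : List Bool) : ℤ := 2 * lcp a y - a.length

/-- The update potential: confirmations count positively exactly when the string is correct. -/
def updatePotential (y : List Bool) (s : List Bool × ℕ) : ℤ :=
  prefixPotential y s.1 + if s.1 = y then (s.2 : ℤ) else -s.2

theorem prefixPotential_append_singleton (y a : List Bool) (b : Bool) :
    prefixPotential y (a ++ [b]) =
      prefixPotential y a + if a ++ [b] <+: y then 1 else -1 := by
  unfold prefixPotential
  split_ifs with h
  · rw [(lcp_eq_length_left_iff _ _).2 h,
      (lcp_eq_length_left_iff _ _).2 ((List.prefix_append a [b]).trans h)]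
    simp
    ring
  · rw [lcp_append_singleton_of_not_prefix_concat _ _ _ h]
    simp
    ring

theorem fst_eq_iff_length_le_updatePotential (y : List Bool) (s : List Bool × ℕ) :
    s.1 = y ↔ (y.length : ℤ) ≤ updatePotential y s := by
  obtain ⟨a, c⟩ := s
  have h₁ := lcp_le_length_left a y
  have h₂ := lcp_le_length_right a y
  have h₃ := lcp_eq_length_left_iff a y
  simp only [updatePotential, prefixPotential]
  split_ifs with h
  · subst h
    have := h₃.2 List.prefix_rfl
    simp only [true_iff]
    omega
  · simp only [h, false_iff]
    intro hle
    exact h ((h₃.1 (by omega)).eq_of_length (by omega))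

theorem append_singleton_prefix_iff (y a : List Bool) (b : Bool) :
    a ++ [b] <+: y ↔ ∃ h : a.length < y.length, a <+: y ∧ y.get ⟨a.length, h⟩ = b := by
  constructor
  · rintro ⟨t, rfl⟩
    exact ⟨by simp, by simp, by simp⟩
  · rintro ⟨h, ⟨t, rfl⟩, hb⟩
    cases t with
    | nil => simp at h
    | cons x t => simp at hb; subst hb; simp

theorem opy_eq_confirm_iff (y a : List Bool) : opy y a = Op.confirm ↔ a = y := by
  unfold opy
  split_ifs <;> simp_all

theorem opy_eq_app_iff (y a : List Bool) (b : Bool) :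
    opy y a = Op.app b ↔ a ++ [b] <+: y := by
  rw [append_singleton_prefix_iff]
  unfold opy
  split_ifs with h₁ h₂
  · simp [h₁]
  · simp [h₂.1, h₂.2]
  · simp only [false_iff]
    rintro ⟨h, hp, -⟩
    exact h₂ ⟨h, hp⟩

theorem opy_eq_del_iff (y a : List Bool) : opy y a = Op.del ↔ ¬ a <+: y := by
  unfold opy
  split_ifs with h₁ h₂
  · simp [h₁]
  · simp [h₂.2]
  · simp only [true_iff]
    intro hp
    rcases hp.length_le.lt_or_eq with h | h
    · exact h₂ ⟨h, hp⟩
    · exact h₁ (hp.eq_of_length h)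

theorem updatePotential_zero (y a : List Bool) :
    updatePotential y (a, 0) = prefixPotential y a := by
  simp [updatePotential]

theorem applyOp_succ_of_ne_confirm (a : List Bool) (c : ℕ) {σ : Op} (h : σ ≠ Op.confirm) :
    applyOp (a, c + 1) σ = (a, c) := by
  cases σ <;> simp_all [applyOp]

theorem updatePotential_applyOp (y : List Bool) (s : List Bool × ℕ) (σ : Op)
    (hne : applyOp s σ ≠ s) :
    updatePotential y (applyOp s σ) =
      updatePotential y s + if applyOp s σ = goodStep y s then 1 else -1 := by
  obtain ⟨a, c⟩ := s
  unfold goodStep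
  by_cases hσ : σ = Op.confirm
  · subst hσ
    by_cases ha : a = y
    · rw [(opy_eq_confirm_iff y a).2 ha]
      simp [applyOp, updatePotential, ha]
      ring
    · have hbad : applyOp (a, c) Op.confirm ≠ applyOp (a, c) (opy y a) := by
        intro h
        have h2 := congrArg Prod.snd h
        have := mt (opy_eq_confirm_iff y a).1 ha
        cases c <;> cases hop : opy y a <;> simp_all [applyOp] <;> omega
      rw [if_neg hbad]
      simp [applyOp, updatePotential, ha]
      ring
  cases c with
  | succ c =>
    rw [applyOp_succ_of_ne_confirm a c hσ]
    by_cases ha : a = y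
    · rw [(opy_eq_confirm_iff y a).2 ha]
      simp [applyOp, updatePotential, ha]
      omega
    · rw [applyOp_succ_of_ne_confirm a c (mt (opy_eq_confirm_iff y a).1 ha)]
      simp [updatePotential, ha]
      ring
  | zero =>
    cases σ with
    | confirm => exact absurd rfl hσ
    | app b =>
      have hgood : applyOp (a, 0) (Op.app b) = applyOp (a, 0) (opy y a) ↔ a ++ [b] <+: y := by
        rw [← opy_eq_app_iff]
        refine ⟨fun h => ?_, fun h => by rw [h]⟩
        cases hop : opy y a with
        | confirm => simp [hop, applyOp] at h
        | app b' => simpa [hop, applyOp, eq_comm] using h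
        | del =>
          have := congrArg (fun s => s.1.length) h
          simp [hop, applyOp] at this
          omega
      simp only [hgood]
      simp only [applyOp, updatePotential_zero, prefixPotential_append_singleton]
    | del =>
      rcases List.eq_nil_or_concat' a with rfl | ⟨a, b, rfl⟩
      · simp [applyOp] at hne
      have hgood : applyOp (a ++ [b], 0) Op.del = applyOp (a ++ [b], 0) (opy y (a ++ [b])) ↔
          ¬ a ++ [b] <+: y := by
        rw [← opy_eq_del_iff]
        refine ⟨fun h => ?_, fun h => by rw [h]⟩
        cases hop : opy y (a ++ [b]) with
        | confirm => simp [hop, applyOp] at h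
        | app b' =>
          have := congrArg (fun s => s.1.length) h
          simp [hop, applyOp] at this
        | del => rfl
      simp only [hgood]
      simp only [applyOp, updatePotential_zero, prefixPotential_append_singleton,
        List.dropLast_concat]
      split_ifs <;> ring

theorem updatePotential_eq_sum (y : List Bool) (m : ℕ) (s : ℕ → List Bool × ℕ)
    (h0 : s 0 = ([], 0))
    (hupd : ∀ i < m, (∃ σ, s (i + 1) = applyOp (s i) σ) ∧ s (i + 1) ≠ s i) :
    updatePotential y (s m) =
      ∑ i ∈ Finset.range m, if s (i + 1) = goodStep y (s i) then 1 else -1 := by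
  induction m with
  | zero => simp [h0, updatePotential, prefixPotential, lcp]
  | succ m ih =>
    obtain ⟨⟨σ, hσ⟩, hne⟩ := hupd m m.lt_succ_self
    rw [Finset.sum_range_succ, ← ih fun i hi => hupd i (by omega), hσ]
    exact updatePotential_applyOp y (s m) σ (hσ ▸ hne)

/-- Lemma (characterization of correct decoding): the final state holds `y` iff the number
of good updates minus the number of bad updates is at least `n`. -/
theorem final_eq_iff_good_minus_bad_ge (y : List Bool) (hn : 1 ≤ y.length)
    (m : ℕ) (s : ℕ → List Bool × ℕ)
    (h0 : s 0 = ([], 0))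
    (hupd : ∀ i < m, (∃ σ, s (i + 1) = applyOp (s i) σ) ∧ s (i + 1) ≠ s i)
    (g : ℕ)
    (hg : g = ((Finset.range m).filter (fun i => s (i + 1) = goodStep y (s i))).card)
    (b : ℕ) (hb : b = m - g) :
    (s m).1 = y ↔ (g : ℤ) - (b : ℤ) ≥ (y.length : ℤ) := by
  have hsum : updatePotential y (s m) = (g : ℤ) - (b : ℤ) := by
    have hsplit := Finset.card_filter_add_card_filter_not (s := Finset.range m)
      (fun i => s (i + 1) = goodStep y (s i))
    rw [Finset.card_range, ← hg] at hsplit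
    rw [updatePotential_eq_sum y m s h0 hupd, Finset.sum_ite, Finset.sum_const, Finset.sum_const,
      ← hg]
    simp only [nsmul_eq_mul]
    omega
  rw [fst_eq_iff_length_le_updatePotential, hsum]
end

section
/- For every state s = (ŷ, c) with ŷ ≠ y, the D(s)-fold iterate of goodStep applied to s equals the state (y, 0). -/
/-- `D(yh, c)`: the number of good updates needed to reach the target. -/
def D (y : List Bool) (s : List Bool × ℕ) : ℕ :=
  if s.1 = y then 0
  else s.2 + (s.1.length - lcp s.1 y) + (y.length - lcp s.1 y)

theorem exists_eq_append_lcp (x y : List Bool) :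
    ∃ p u v, x = p ++ u ∧ y = p ++ v ∧ lcp x y = p.length ∧ lcp u v = 0 := by
  induction x generalizing y with
  | nil => exact ⟨[], [], y, rfl, rfl, by simp [lcp], by simp [lcp]⟩
  | cons a as ih =>
    cases y with
    | nil => exact ⟨[], a :: as, [], rfl, rfl, by simp [lcp], by simp [lcp]⟩
    | cons b bs =>
      by_cases h : a = b
      · subst h
        obtain ⟨p, u, v, rfl, rfl, hp, h0⟩ := ih bs
        exact ⟨a :: p, u, v, rfl, rfl, by simp [lcp, hp], h0⟩
      · exact ⟨[], a :: as, b :: bs, rfl, rfl, by simp [lcp, h], by simp [lcp, h]⟩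

theorem lcp_eq_zero_of_append {u w v : List Bool} (h : lcp (u ++ w) v = 0) : lcp u v = 0 := by
  cases u <;> cases v <;> simp_all [lcp]

theorem not_append_singleton_isPrefix {u v : List Bool} {b : Bool}
    (h : lcp (u ++ [b]) v = 0) : ¬ u ++ [b] <+: v := by
  rintro ⟨t, rfl⟩
  cases u <;> simp [lcp] at h

theorem goodStep_succ {y x : List Bool} (hx : x ≠ y) (c : ℕ) :
    goodStep y (x, c + 1) = (x, c) := by
  unfold goodStep opy
  split_ifs <;> first | contradiction | rfl

theorem iterate_goodStep_counter {y x : List Bool} (hx : x ≠ y) (c : ℕ) :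
    (goodStep y)^[c] (x, c) = (x, 0) := by
  induction c with
  | zero => rfl
  | succ c ih => rw [Function.iterate_succ_apply, goodStep_succ hx, ih]

theorem goodStep_append (p v : List Bool) (b : Bool) :
    goodStep (p ++ b :: v) (p, 0) = (p ++ [b], 0) := by
  simp [goodStep, opy, applyOp]

theorem iterate_goodStep_append (p v : List Bool) :
    (goodStep (p ++ v))^[v.length] (p, 0) = (p ++ v, 0) := by
  induction v generalizing p with
  | nil => simp
  | cons b v ih =>
    rw [List.length_cons, Function.iterate_succ_apply, goodStep_append]
    simpa using ih (p ++ [b])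

theorem goodStep_delete {p u v : List Bool} {b : Bool} (h : lcp (u ++ [b]) v = 0) :
    goodStep (p ++ v) (p ++ (u ++ [b]), 0) = (p ++ u, 0) := by
  have hpre := not_append_singleton_isPrefix h
  have hne : u ++ [b] ≠ v := fun e => hpre (e ▸ List.prefix_rfl)
  have hop : opy (p ++ v) (p ++ (u ++ [b])) = Op.del := by
    unfold opy
    rw [if_neg (by simpa using hne),
      dif_neg fun hp => hpre ((List.prefix_append_right_inj p).1 hp.2)]
  simp only [goodStep, hop, applyOp]
  rw [← List.append_assoc, List.dropLast_concat]

theorem iterate_goodStep_delete {p u v : List Bool} (h : lcp u v = 0) :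
    (goodStep (p ++ v))^[u.length] (p ++ u, 0) = (p, 0) := by
  induction u using List.reverseRecOn with
  | nil => simp
  | append_singleton u b ih =>
    rw [List.length_append, List.length_singleton, Function.iterate_succ_apply,
      goodStep_delete h, ih (lcp_eq_zero_of_append h)]

/-- Starting from a state whose string is not `y`, after `D(s)` good steps the state
is exactly `(y, 0)`. -/
theorem iterate_goodStep_D (y : List Bool) (hn : 1 ≤ y.length)
    (s : List Bool × ℕ) (hne : s.1 ≠ y) :
    (goodStep y)^[D y s] s = (y, 0) := by
  obtain ⟨x, c⟩ := s
  have hx : x ≠ y := hne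
  obtain ⟨p, u, v, rfl, rfl, hp, h0⟩ := exists_eq_append_lcp x y
  have hD : D (p ++ v) (p ++ u, c) = v.length + (u.length + c) := by
    simp only [D, if_neg hx, hp, List.length_append]
    omega
  rw [hD, Function.iterate_add_apply, Function.iterate_add_apply, iterate_goodStep_counter hx,
    iterate_goodStep_delete h0, iterate_goodStep_append]
end
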